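/- Let V be a positive natural number. The softmax map is (1/2)-Lipschitz in the Euclidean norm: for all x, y : Fin V → ℝ, ‖softmax x − softmax y‖₂ ≤ (1/2) · ‖x − y‖₂. -/

import Mathlib

/-- Softmax of a vector of logits. -/
noncomputable def softmax {V : ℕ} (x : Fin V → ℝ) : Fin V → ℝ :=
  fun i => Real.exp (x i) / ∑ j, Real.exp (x j)

/-- Total variation distance between two vectors, `(1/2) · ∑ i |p i − q i|`. -/
noncomputable def tvDist {V : ℕ} (p q : Fin V → ℝ) : ℝ :=
  (1 / 2) * ∑ i, |p i - q i|

/-- Euclidean (ℓ2) norm of a vector. -/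
noncomputable def l2norm {d : ℕ} (v : Fin d → ℝ) : ℝ :=
  Real.sqrt (∑ k, (v k) ^ 2)

/-- Frobenius (entrywise ℓ2) norm of a matrix. -/
noncomputable def frobNorm {L d : ℕ} (M : Fin L → Fin d → ℝ) : ℝ :=
  Real.sqrt (∑ j, ∑ k, (M j k) ^ 2)

/-- The variance of `u` under a probability vector is at most half its squared Euclidean norm. -/
lemma weighted_variance_le_half_sum_sq {ι : Type*} [Fintype ι] (p u : ι → ℝ)
    (hp : ∀ i, 0 ≤ p i) (hsum : ∑ i, p i = 1) :
    ∑ i, p i * u i ^ 2 - (∑ i, p i * u i) ^ 2 ≤ (1 / 2) * ∑ i, u i ^ 2 := by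
  classical
  have cross : ∑ i, ∑ j, -((p i * u i) * (p j * u j)) ≤
      ∑ i, ∑ j, (p i * u i ^ 2 * p j / 2 + p i * (p j * u j ^ 2) / 2 -
        if i = j then 2 * p i ^ 2 * u i ^ 2 else 0) := by
    refine Finset.sum_le_sum fun i _ => Finset.sum_le_sum fun j _ => ?_
    split_ifs with h
    · subst h
      exact le_of_eq (by ring)
    · nlinarith [mul_nonneg (mul_nonneg (hp i) (hp j)) (sq_nonneg (u i + u j))]
  have lhs : ∑ i, ∑ j, -((p i * u i) * (p j * u j)) = -(∑ i, p i * u i) ^ 2 := by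
    simp only [Finset.sum_neg_distrib, sq, Finset.sum_mul_sum]
  have rhs : ∑ i, ∑ j, (p i * u i ^ 2 * p j / 2 + p i * (p j * u j ^ 2) / 2 -
        if i = j then 2 * p i ^ 2 * u i ^ 2 else 0) =
      ∑ i, p i * u i ^ 2 - ∑ i, 2 * p i ^ 2 * u i ^ 2 := by
    simp only [Finset.sum_sub_distrib, Finset.sum_add_distrib, Finset.sum_ite_eq,
      Finset.mem_univ, if_true, ← Finset.sum_div, ← Finset.mul_sum, ← Finset.sum_mul, hsum]
    ring
  have diag : ∑ i, p i * u i ^ 2 + ∑ i, p i * u i ^ 2 - ∑ i, 2 * p i ^ 2 * u i ^ 2 ≤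
      (1 / 2) * ∑ i, u i ^ 2 := by
    rw [Finset.mul_sum, ← Finset.sum_add_distrib, ← Finset.sum_sub_distrib]
    refine Finset.sum_le_sum fun i _ => ?_
    nlinarith [mul_nonneg (sq_nonneg (p i - 1 / 2)) (sq_nonneg (u i))]
  linarith

/-- Covariance under a probability vector is at most the average of the two variances. -/
lemma weighted_covariance_le {ι : Type*} [Fintype ι] (p u v : ι → ℝ)
    (hp : ∀ i, 0 ≤ p i) (hsum : ∑ i, p i = 1) :
    ∑ i, p i * (u i * v i) - (∑ i, p i * u i) * (∑ i, p i * v i) ≤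
      ((∑ i, p i * u i ^ 2 - (∑ i, p i * u i) ^ 2) +
        (∑ i, p i * v i ^ 2 - (∑ i, p i * v i) ^ 2)) / 2 := by
  have jensen : (∑ i, p i * (u i - v i)) ^ 2 ≤ ∑ i, p i * (u i - v i) ^ 2 :=
    Real.pow_arith_mean_le_arith_mean_pow_of_even _ _ _
      (fun i _ => hp i) hsum even_two
  have hmean : ∑ i, p i * (u i - v i) = ∑ i, p i * u i - ∑ i, p i * v i := by
    simp only [mul_sub, Finset.sum_sub_distrib]
  have hsq : ∑ i, p i * (u i - v i) ^ 2 =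
      ∑ i, p i * u i ^ 2 + ∑ i, p i * v i ^ 2 - 2 * ∑ i, p i * (u i * v i) := by
    rw [Finset.mul_sum, ← Finset.sum_add_distrib, ← Finset.sum_sub_distrib]
    exact Finset.sum_congr rfl fun i _ => by ring
  rw [hmean, hsq] at jensen
  linarith

lemma sum_exp_pos {ι : Type*} [Fintype ι] [Nonempty ι] (x : ι → ℝ) :
    0 < ∑ i, Real.exp (x i) :=
  Finset.sum_pos (fun _ _ => Real.exp_pos _) Finset.univ_nonempty

lemma softmax_nonneg {V : ℕ} (x : Fin V → ℝ) (i : Fin V) : 0 ≤ softmax x i :=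
  div_nonneg (Real.exp_pos _).le (Finset.sum_nonneg fun _ _ => (Real.exp_pos _).le)

lemma sum_softmax {V : ℕ} [NeZero V] (x : Fin V → ℝ) : ∑ i, softmax x i = 1 := by
  simp only [softmax, ← Finset.sum_div]
  exact div_self (sum_exp_pos x).ne'

/-- The derivative of softmax along a line. -/
lemma hasDerivAt_softmax_line {V : ℕ} [NeZero V] (y w : Fin V → ℝ) (i : Fin V) (t : ℝ) :
    HasDerivAt (fun s => softmax (fun j => y j + s * w j) i)
      (softmax (fun j => y j + t * w j) i *
        (w i - ∑ j, softmax (fun j => y j + t * w j) j * w j)) t := by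
  have hexp (j : Fin V) : HasDerivAt (fun s => Real.exp (y j + s * w j))
      (Real.exp (y j + t * w j) * w j) t := by
    simpa using (((hasDerivAt_id t).mul_const (w j)).const_add (y j)).exp
  have hZ : HasDerivAt (fun s => ∑ j, Real.exp (y j + s * w j))
      (∑ j, Real.exp (y j + t * w j) * w j) t := HasDerivAt.fun_sum fun j _ => hexp j
  have hne := (sum_exp_pos fun j => y j + t * w j).ne'
  refine ((hexp i).fun_div hZ hne).congr_deriv ?_
  simp only [softmax, div_mul_eq_mul_div, ← Finset.sum_div]
  field_simp

/-- Softmax is `1/2`-Lipschitz in the Euclidean norm. -/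
theorem softmax_lipschitz_half {V : ℕ} (hV : 0 < V) (x y : Fin V → ℝ) :
    l2norm (fun i => softmax x i - softmax y i) ≤ (1 / 2) * l2norm (fun i => x i - y i) := by
  have : NeZero V := ⟨hV.ne'⟩
  let d : Fin V → ℝ := fun i => softmax x i - softmax y i
  let w : Fin V → ℝ := fun i => x i - y i
  have hderiv (t : ℝ) := HasDerivAt.fun_sum (u := Finset.univ) fun i _ =>
    (hasDerivAt_softmax_line y w i t).const_mul (d i)
  obtain ⟨t, -, ht⟩ := exists_hasDerivAt_eq_slope _ _ zero_lt_one
    (fun t _ => (hderiv t).continuousAt.continuousWithinAt) (fun t _ => hderiv t)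
  let p := softmax fun j => y j + t * w j
  have hp : ∀ i, 0 ≤ p i := softmax_nonneg _
  have hsum : ∑ i, p i = 1 := sum_softmax _
  have hcov : ∑ i, d i ^ 2 =
      ∑ i, p i * (d i * w i) - (∑ i, p i * d i) * (∑ i, p i * w i) := by
    have hslope : ∑ i, d i ^ 2 = ∑ i, d i * (p i * (w i - ∑ j, p j * w j)) := by
      refine Eq.trans ?_ ht.symm
      simp only [w, one_mul, zero_mul, add_zero, add_sub_cancel, sub_zero, div_one,
        ← Finset.sum_sub_distrib, ← mul_sub]
      simp only [d, sq]
    rw [hslope, Finset.sum_mul, ← Finset.sum_sub_distrib]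
    exact Finset.sum_congr rfl fun i _ => by ring
  have hbound := weighted_covariance_le p (fun i => 2 * d i) w hp hsum
  have hd := weighted_variance_le_half_sum_sq p (fun i => 2 * d i) hp hsum
  have hw := weighted_variance_le_half_sum_sq p w hp hsum
  have hscale : ∑ i, (2 * d i) ^ 2 = 4 * ∑ i, d i ^ 2 := by
    rw [Finset.mul_sum]
    exact Finset.sum_congr rfl fun i _ => by ring
  have hscale_cov : ∑ i, p i * (2 * d i * w i) - (∑ i, p i * (2 * d i)) * (∑ i, p i * w i) =
      2 * ∑ i, d i ^ 2 := by
    simp only [hcov, mul_sub, Finset.mul_sum, Finset.sum_mul, mul_left_comm, mul_assoc]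
  have hsq : ∑ i, d i ^ 2 ≤ (1 / 2) ^ 2 * ∑ i, w i ^ 2 := by linarith
  calc l2norm d ≤ Real.sqrt ((1 / 2) ^ 2 * ∑ i, w i ^ 2) := Real.sqrt_le_sqrt hsq
    _ = (1 / 2) * l2norm w := by
      rw [Real.sqrt_mul (by positivity), Real.sqrt_sq (by norm_num), l2norm]
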